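/- Let θ ∈ (−π,π], γ = exp(iθ/2), and suppose θ ≠ 0 and θ ≠ π. Then neither 𝔏_θ nor 𝔏_{π−θ} admits a pair of unit vectors φ, ψ ∈ ℂ⁴ with ⟨ψ|M|φ⟩ = 0 and ⟨φ|M|φ⟩ = ⟨ψ|M|ψ⟩ for all M in the respective subspace, but the tensor product 𝔏_θ ⊗ 𝔏_{π−θ} does admit such a pair in ℂ⁴ ⊗ ℂ⁴, namely φ = (1/√2)(|11⟩ + i|22⟩) and ψ = (1/√2)(|33⟩ + i|44⟩). -/

import Mathlib

open Matrix Complex Finset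

def Lset (θ : ℝ) : Set (Matrix (Fin 4) (Fin 4) ℂ) :=
  {M | ∃ a b c d : ℂ,
    M = !![a, b, Complex.exp (Complex.I * θ / 2) * c, d;
           b, a, d, (starRingEnd ℂ) (Complex.exp (Complex.I * θ / 2)) * c;
           (starRingEnd ℂ) (Complex.exp (Complex.I * θ / 2)) * c, d, a, b;
           d, Complex.exp (Complex.I * θ / 2) * c, b, a]}

/-- Kronecker product of two `4 × 4` matrices, on the index type `Fin 4 × Fin 4`. -/
def tens (M N : Matrix (Fin 4) (Fin 4) ℂ) :
    Matrix (Fin 4 × Fin 4) (Fin 4 × Fin 4) ℂ :=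
  fun i j => M i.1 j.1 * N i.2 j.2

noncomputable def phi2 : Fin 4 × Fin 4 → ℂ :=
  fun v => if v = (0, 0) then (1 / Real.sqrt 2 : ℂ)
    else if v = (1, 1) then Complex.I / Real.sqrt 2 else 0

noncomputable def psi2 : Fin 4 × Fin 4 → ℂ :=
  fun v => if v = (2, 2) then (1 / Real.sqrt 2 : ℂ)
    else if v = (3, 3) then Complex.I / Real.sqrt 2 else 0


lemma sector_param (a b c d : ℂ) (h1 : star c * a + star d * b = 0)
    (h2 : normSq a + normSq b = normSq c + normSq d) :
    ∃ l : ℂ, normSq l = 1 ∧ c = -l * star b ∧ d = l * star a := by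
  by_cases hn : normSq a + normSq b = 0
  · have ha : normSq a = 0 := by nlinarith [normSq_nonneg a, normSq_nonneg b]
    have hb : normSq b = 0 := by nlinarith [normSq_nonneg a, normSq_nonneg b]
    have hc : normSq c = 0 := by nlinarith [normSq_nonneg c, normSq_nonneg d]
    have hd : normSq d = 0 := by nlinarith [normSq_nonneg c, normSq_nonneg d]
    rw [normSq_eq_zero] at ha hb hc hd
    exact ⟨1, by simp, by simp [hb, hc], by simp [ha, hd]⟩
  · have hnC : a * star a + b * star b ≠ 0 := by
      intro h
      apply hn
      have : ((normSq a + normSq b : ℝ) : ℂ) = 0 := by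
        push_cast
        rw [← mul_conj, ← mul_conj]
        exact h
      exact_mod_cast this
    have h1' : c * star a + d * star b = 0 := by
      have := congrArg star h1
      simpa using this
    have hc : c = -((a * d - b * c) / (a * star a + b * star b)) * star b := by
      field_simp
      linear_combination a * h1'
    have hd : d = ((a * d - b * c) / (a * star a + b * star b)) * star a := by
      field_simp
      linear_combination b * h1'
    refine ⟨_, ?_, hc, hd⟩
    set l := (a * d - b * c) / (a * star a + b * star b)
    have e1 : normSq c = normSq l * normSq b := by
      rw [hc, map_mul, normSq_neg]; simp
    have e2 : normSq d = normSq l * normSq a := by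
      rw [hd, map_mul]; simp
    rw [e1, e2] at h2
    have : (normSq l - 1) * (normSq a + normSq b) = 0 := by linarith
    rcases mul_eq_zero.mp this with h | h
    · linarith
    · exact absurd h hn

lemma sector (a b c d : ℂ) (h1 : star c * a + star d * b = 0)
    (h2 : normSq a + normSq b = normSq c + normSq d) :
    (2 * (star a * b).re) ^ 2 + normSq (star c * b + star d * a) = (normSq a + normSq b) ^ 2 ∧
    (2 * (star a * b).re) * (-2 * (star a * b).im)
      + ((star c * b + star d * a) * star (I * (star c * b - star d * a))).re = 0 ∧
    star c * d + star a * b = 0 := by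
  obtain ⟨l, hl, rfl, rfl⟩ := sector_param a b c d h1 h2
  have hlC : star l * l = 1 := by
    have := mul_conj l
    rw [hl] at this
    rw [mul_comm]; simpa using this
  refine ⟨?_, ?_, ?_⟩
  · have e : star (-l * star b) * b + star (l * star a) * a = star l * (a * a - b * b) := by
      simp; ring
    rw [e, map_mul]
    have : normSq (star l) = 1 := by rw [← hl]; simp
    rw [this]
    simp [normSq_apply]
    ring
  · have e : (star (-l * star b) * b + star (l * star a) * a) *
        star (I * (star (-l * star b) * b - star (l * star a) * a))
        = I * ((a * a - b * b) * star (a * a + b * b)) := by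
      simp at hlC ⊢
      linear_combination (I * ((a * a - b * b) * ((starRingEnd ℂ) a ^ 2 + (starRingEnd ℂ) b ^ 2))) * hlC
    rw [e]
    simp
    ring
  · simp at hlC ⊢
    linear_combination (-(starRingEnd ℂ) a * b) * hlC

lemma core (x y : ℝ) (hx : x ≠ 0) (a b c d a' b' c' d' : ℂ)
    (h1 : star c * a + star d * b = 0)
    (h2 : normSq a + normSq b = normSq c + normSq d)
    (h1' : star c' * a' + star d' * b' = 0)
    (h2' : normSq a' + normSq b' = normSq c' + normSq d')
    (hU : (star c * b + star d * a) + (star c' * b' + star d' * a') = 0)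
    (hV : x * ((star c * b + star d * a) - (star c' * b' + star d' * a'))
      + y * (I * (star c * b - star d * a) - I * (star c' * b' - star d' * a')) = 0)
    (hR : (star a * b).re + (star a' * b').re = (star c * d).re + (star c' * d').re)
    (hS : x * ((star a * b).re - (star a' * b').re) - y * ((star a * b).im - (star a' * b').im)
      = x * ((star c * d).re - (star c' * d').re) - y * ((star c * d).im - (star c' * d').im)) :
    normSq a + normSq b = 0 ∧ normSq a' + normSq b' = 0 := by
  obtain ⟨s1, s2, s3⟩ := sector a b c d h1 h2
  obtain ⟨t1, t2, t3⟩ := sector a' b' c' d' h1' h2'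
  have s3' : star c * d = - (star a * b) := by linear_combination s3
  have t3' : star c' * d' = - (star a' * b') := by linear_combination t3
  rw [s3', t3'] at hR hS
  generalize star a * b = m at *
  generalize star a' * b' = m' at *
  generalize star c * b + star d * a = U at *
  generalize star c' * b' + star d' * a' = U' at *
  generalize I * (star c * b - star d * a) = V at *
  generalize I * (star c' * b' - star d' * a') = V' at *
  obtain rfl : U' = -U := by linear_combination hU
  generalize normSq a + normSq b = n at *
  generalize normSq a' + normSq b' = n' at *
  have v1 := congrArg re hV
  have v2 := congrArg im hV
  simp [normSq_apply] at s1 s2 t1 t2 v1 v2 hR hS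
  have hm : m'.re = - m.re := by linarith
  rw [hm] at t1 t2 hS
  have key : x * n ^ 2 = 0 := by
    linear_combination (-x) * s1 - y / 2 * s2 - y / 2 * t2 + U.re / 2 * v1 + U.im / 2 * v2
      + m.re * hS
  have hn : n ^ 2 = 0 := by simpa [hx] using key
  have hn' : n' ^ 2 = 0 := by linarith
  exact ⟨by simpa using hn, by simpa using hn'⟩

lemma noPair (θ : ℝ) (hx : Real.cos (θ / 2) ≠ 0) :
    ¬ ∃ φ ψ : Fin 4 → ℂ, (∑ i, ‖φ i‖ ^ 2 = 1) ∧ (∑ i, ‖ψ i‖ ^ 2 = 1) ∧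
      ∀ M ∈ Lset θ, star ψ ⬝ᵥ M.mulVec φ = 0 ∧
        star φ ⬝ᵥ M.mulVec φ = star ψ ⬝ᵥ M.mulVec ψ := by
  rintro ⟨φ, ψ, hφ, -, h⟩
  have hg : Complex.exp (Complex.I * θ / 2) = Real.cos (θ / 2) + Real.sin (θ / 2) * I := by
    rw [ofReal_cos, ofReal_sin, ← exp_mul_I]; congr 1; push_cast; ring
  have hA := h _ ⟨1, 0, 0, 0, rfl⟩
  have hB := h _ ⟨0, 1, 0, 0, rfl⟩
  have hC := h _ ⟨0, 0, 1, 0, rfl⟩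
  have hD := h _ ⟨0, 0, 0, 1, rfl⟩
  clear h
  rw [hg] at hA hB hC hD
  generalize Real.cos (θ / 2) = x at *
  generalize Real.sin (θ / 2) = y at *
  simp [dotProduct, Matrix.mulVec, Fin.sum_univ_four] at hA hB hC hD
  simp only [Fin.sum_univ_four, ← normSq_eq_norm_sq] at hφ
  obtain ⟨A1, A2⟩ := hA
  obtain ⟨B1, B2⟩ := hB
  obtain ⟨C1, C2⟩ := hC
  obtain ⟨D1, D2⟩ := hD
  have A2r := congrArg re A2
  have B2r := congrArg re B2
  have C2r := congrArg re C2
  have D2r := congrArg re D2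
  simp at A2r B2r C2r D2r
  have := core x y hx (φ 0 + φ 3) (φ 1 + φ 2) (ψ 0 + ψ 3) (ψ 1 + ψ 2)
    (φ 0 - φ 3) (φ 1 - φ 2) (ψ 0 - ψ 3) (ψ 1 - ψ 2)
    (by simp; linear_combination A1 + D1)
    (by simp [normSq_apply]; linear_combination A2r + D2r)
    (by simp; linear_combination A1 - D1)
    (by simp [normSq_apply]; linear_combination A2r - D2r)
    (by simp; linear_combination 2 * B1)
    (by simp; linear_combination 2 * C1)
    (by simp; linear_combination B2r)
    (by simp; linear_combination C2r)
  obtain ⟨e1, e2⟩ := this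
  simp [normSq_apply] at e1 e2 hφ
  linarith

lemma two_term (i j k l : Fin 4 × Fin 4) (hij : i ≠ j) (hkl : k ≠ l) (p q r s : ℂ)
    (M : Matrix (Fin 4 × Fin 4) (Fin 4 × Fin 4) ℂ) :
    star (fun v => if v = i then p else if v = j then q else 0 : Fin 4 × Fin 4 → ℂ) ⬝ᵥ
      M.mulVec (fun v => if v = k then r else if v = l then s else 0) =
    star p * (M i k * r + M i l * s) + star q * (M j k * r + M j l * s) := by
  have e : ∀ (i j : Fin 4 × Fin 4) (_ : i ≠ j) (p q : ℂ),
      (fun v => if v = i then p else if v = j then q else 0 : Fin 4 × Fin 4 → ℂ)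
        = Pi.single i p + Pi.single j q := by
    intro i j hij p q
    ext v
    by_cases h1 : v = i
    · subst h1; simp [hij]
    · by_cases h2 : v = j
      · subst h2; simp [h1]
      · simp [h1, h2]
  rw [e i j hij, e k l hkl]
  simp [Matrix.mulVec_add, add_dotProduct]
  ring

lemma norm_two (i j : Fin 4 × Fin 4) (hij : i ≠ j) (p q : ℂ) :
    ∑ v, ‖(if v = i then p else if v = j then q else 0 : ℂ)‖ ^ 2 = ‖p‖ ^ 2 + ‖q‖ ^ 2 := by
  have : ∀ v, ‖(if v = i then p else if v = j then q else 0 : ℂ)‖ ^ 2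
      = (if v = i then ‖p‖ ^ 2 else 0) + (if v = j then ‖q‖ ^ 2 else 0) := by
    intro v
    by_cases h1 : v = i
    · subst h1; simp [hij]
    · by_cases h2 : v = j
      · subst h2; simp [h1]
      · simp [h1, h2]
  simp [this, Finset.sum_add_distrib]

theorem stmt_17 (θ : ℝ) (hθ : θ ∈ Set.Ioc (-Real.pi) Real.pi)
    (h0 : θ ≠ 0) (hπ : θ ≠ Real.pi) :
    (¬ ∃ φ ψ : Fin 4 → ℂ, (∑ i, ‖φ i‖ ^ 2 = 1) ∧ (∑ i, ‖ψ i‖ ^ 2 = 1) ∧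
      ∀ M ∈ Lset θ, star ψ ⬝ᵥ M.mulVec φ = 0 ∧
        star φ ⬝ᵥ M.mulVec φ = star ψ ⬝ᵥ M.mulVec ψ) ∧
    (¬ ∃ φ ψ : Fin 4 → ℂ, (∑ i, ‖φ i‖ ^ 2 = 1) ∧ (∑ i, ‖ψ i‖ ^ 2 = 1) ∧
      ∀ M ∈ Lset (Real.pi - θ), star ψ ⬝ᵥ M.mulVec φ = 0 ∧
        star φ ⬝ᵥ M.mulVec φ = star ψ ⬝ᵥ M.mulVec ψ) ∧
    ((∑ i, ‖phi2 i‖ ^ 2 = 1) ∧ (∑ i, ‖psi2 i‖ ^ 2 = 1) ∧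
      ∀ M₁ ∈ Lset θ, ∀ M₂ ∈ Lset (Real.pi - θ),
        star psi2 ⬝ᵥ (tens M₁ M₂).mulVec phi2 = 0 ∧
        star phi2 ⬝ᵥ (tens M₁ M₂).mulVec phi2 =
          star psi2 ⬝ᵥ (tens M₁ M₂).mulVec psi2) := by
  have hc1 : Real.cos (θ / 2) ≠ 0 := by
    have := hθ.1
    have := lt_of_le_of_ne hθ.2 hπ
    exact (Real.cos_pos_of_mem_Ioo ⟨by linarith, by linarith⟩).ne'
  have hc2 : Real.cos ((Real.pi - θ) / 2) ≠ 0 := by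
    have e : (Real.pi - θ) / 2 = Real.pi / 2 - θ / 2 := by ring
    rw [e, Real.cos_pi_div_two_sub]
    have h1 := hθ.1
    have h2 := hθ.2
    have := Real.pi_pos
    intro h
    rw [Real.sin_eq_zero_iff_of_lt_of_lt (by linarith) (by linarith)] at h
    exact h0 (by linarith)
  have hs : ‖(1 / Real.sqrt 2 : ℂ)‖ ^ 2 + ‖(Complex.I / Real.sqrt 2 : ℂ)‖ ^ 2 = 1 := by
    simp
    norm_num
  refine ⟨noPair θ hc1, noPair _ hc2, ?_, ?_, ?_⟩
  · unfold phi2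
    rw [norm_two _ _ (by decide), hs]
  · unfold psi2
    rw [norm_two _ _ (by decide), hs]
  · rintro _ ⟨a, b, c, d, rfl⟩ _ ⟨a', b', c', d', rfl⟩
    have hg : Complex.exp (Complex.I * θ / 2) *
        Complex.exp (Complex.I * ((Real.pi - θ : ℝ) : ℂ) / 2) = I := by
      rw [← Complex.exp_add]
      refine Eq.trans ?_ Complex.exp_pi_div_two_mul_I
      congr 1; push_cast; ring
    have hg' : (starRingEnd ℂ) (Complex.exp (Complex.I * θ / 2)) *
        (starRingEnd ℂ) (Complex.exp (Complex.I * ((Real.pi - θ : ℝ) : ℂ) / 2)) = -I := by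
      rw [← map_mul, hg, conj_I]
    generalize Complex.exp (Complex.I * θ / 2) = g at *
    generalize Complex.exp (Complex.I * ((Real.pi - θ : ℝ) : ℂ) / 2) = g' at *
    generalize (starRingEnd ℂ) g = k at *
    generalize (starRingEnd ℂ) g' = k' at *
    unfold phi2 psi2
    rw [two_term _ _ _ _ (by decide) (by decide), two_term _ _ _ _ (by decide) (by decide),
      two_term _ _ _ _ (by decide) (by decide)]
    generalize Real.sqrt 2 = t
    simp [tens]
    linear_combination (c * c' / t ^ 2) * hg' - (I ^ 2 * c * c' / t ^ 2) * hg
        - (I * c * c' / t ^ 2) * I_sq
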